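/- arXiv:2512.12094 — 6 statements merged into one kernel-verified Lean document; each statement's English description precedes it below -/
import Mathlib

section
/- Single-step symmetry merging preserves symmetric expectation values: under the stated setup, if ρ is a d×d complex matrix commuting with (A g : Matrix) for every g ∈ G, then for every d×d complex matrix O one has Matrix.trace (ρ * merge(O)) = Matrix.trace (ρ * O). -/
open Matrix

/-- Expansion of a matrix in a trace-orthonormal spanning family. -/
theorem eq_sum_trace_smul_of_trace_orthonormal {n ι : Type*} [Fintype n] [Fintype ι]
    [DecidableEq ι] (s : ι → Matrix n n ℂ)
    (horth : ∀ i j, Matrix.trace (s i * s j) = if i = j then 1 else 0)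
    (hspan : Submodule.span ℂ (Set.range s) = ⊤) (O : Matrix n n ℂ) :
    O = ∑ i, Matrix.trace (s i * O) • s i := by
  have hO : O ∈ Submodule.span ℂ (Set.range s) := hspan ▸ Submodule.mem_top
  induction hO using Submodule.span_induction with
  | mem x hx =>
    obtain ⟨j, rfl⟩ := hx
    simp [horth]
  | zero => simp
  | add x y _ _ hx hy =>
    simp only [mul_add, Matrix.trace_add, add_smul, Finset.sum_add_distrib, ← hx, ← hy]
  | smul a x _ hx =>
    simp only [Matrix.mul_smul, Matrix.trace_smul, smul_assoc, ← Finset.smul_sum, ← hx]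

/-- Conjugation by a unitary commuting with `ρ` does not change expectation values in `ρ`. -/
theorem trace_mul_unitary_conj_of_commute {n : Type*} [Fintype n] [DecidableEq n]
    (U : Matrix.unitaryGroup n ℂ) (ρ X : Matrix n n ℂ)
    (hρ : ρ * (U : Matrix n n ℂ) = (U : Matrix n n ℂ) * ρ) :
    Matrix.trace (ρ * ((U : Matrix n n ℂ) * X * (U : Matrix n n ℂ)ᴴ)) = Matrix.trace (ρ * X) := by
  have hU : (U : Matrix n n ℂ)ᴴ * (U : Matrix n n ℂ) = 1 := Unitary.coe_star_mul_self U
  rw [← mul_assoc, ← mul_assoc, hρ, Matrix.trace_mul_comm, mul_assoc, ← mul_assoc, hU, one_mul]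

/-- Single-step symmetry merging preserves symmetric expectation values.
Setup: `s` is a trace-orthonormal Hermitian basis of `d×d` complex matrices, `G` a finite
group with unitary representation `A` permuting the basis via `π` (i.e.
`A g * s i * (A g)ᴴ = s (π g i)`), `R` a set of orbit representatives (exactly one element
of each orbit of `i ↦ π g i`), and
`merge O = Σ_{r ∈ R} (Σ_{i ∈ orbit of r} Tr (s i * O)) • s r`.
If `ρ` commutes with every `A g`, then `Tr (ρ * merge O) = Tr (ρ * O)` for every `O`. -/
theorem trace_merge_eq_of_symmetric {d : ℕ} (hd : 1 ≤ d)
    (s : Fin (d ^ 2) → Matrix (Fin d) (Fin d) ℂ)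
    (hherm : ∀ i, (s i)ᴴ = s i)
    (horth : ∀ i j, Matrix.trace (s i * s j) = if i = j then 1 else 0)
    (hspan : Submodule.span ℂ (Set.range s) = ⊤)
    {G : Type*} [Group G] [Fintype G]
    (A : G →* Matrix.unitaryGroup (Fin d) ℂ)
    (π : G →* Equiv.Perm (Fin (d ^ 2)))
    (hA : ∀ (g : G) (i : Fin (d ^ 2)),
      (A g : Matrix (Fin d) (Fin d) ℂ) * s i * ((A g : Matrix (Fin d) (Fin d) ℂ))ᴴ = s (π g i))
    (R : Finset (Fin (d ^ 2)))
    (hR : ∀ i : Fin (d ^ 2), ∃! r, r ∈ R ∧ i ∈ Finset.univ.image (fun g : G => π g r))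
    (merge : Matrix (Fin d) (Fin d) ℂ → Matrix (Fin d) (Fin d) ℂ)
    (hmerge : ∀ O : Matrix (Fin d) (Fin d) ℂ, merge O = ∑ r ∈ R,
      (∑ i ∈ Finset.univ.image (fun g : G => π g r), Matrix.trace (s i * O)) • s r)
    (ρ : Matrix (Fin d) (Fin d) ℂ)
    (hρ : ∀ g : G, ρ * (A g : Matrix (Fin d) (Fin d) ℂ) = (A g : Matrix (Fin d) (Fin d) ℂ) * ρ) :
    ∀ O : Matrix (Fin d) (Fin d) ℂ,
      Matrix.trace (ρ * merge O) = Matrix.trace (ρ * O) := by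
  intro O
  have hinv : ∀ (g : G) (r : Fin (d ^ 2)),
      Matrix.trace (ρ * s (π g r)) = Matrix.trace (ρ * s r) := fun g r => by
    rw [← hA g r, trace_mul_unitary_conj_of_commute (A g) ρ (s r) (hρ g)]
  have hdisj : (R : Set (Fin (d ^ 2))).PairwiseDisjoint
      (fun r => Finset.univ.image (fun g : G => π g r)) := by
    intro r hr r' hr' hne
    exact Finset.disjoint_left.mpr fun i hi hi' =>
      hne ((hR i).unique ⟨hr, hi⟩ ⟨hr', hi'⟩)
  have hcover : (Finset.univ : Finset (Fin (d ^ 2))) =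
      R.biUnion (fun r => Finset.univ.image (fun g : G => π g r)) := by
    refine (Finset.eq_univ_of_forall fun i => ?_).symm
    obtain ⟨r, hr, -⟩ := hR i
    exact Finset.mem_biUnion.mpr ⟨r, hr⟩
  conv_rhs => rw [eq_sum_trace_smul_of_trace_orthonormal s horth hspan O]
  rw [hmerge, hcover, Finset.sum_biUnion hdisj, Finset.mul_sum, Finset.mul_sum,
    Matrix.trace_sum, Matrix.trace_sum]
  refine Finset.sum_congr rfl fun r _ => ?_
  rw [Finset.sum_smul, Finset.mul_sum, Finset.mul_sum, Matrix.trace_sum, Matrix.trace_sum]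
  refine Finset.sum_congr rfl fun i hi => ?_
  obtain ⟨g, -, rfl⟩ := Finset.mem_image.mp hi
  rw [Matrix.mul_smul, Matrix.mul_smul, Matrix.trace_smul, Matrix.trace_smul, hinv]
end

section
/- Correctness of symmetry-merging Pauli propagation (Theorem 1): under the stated setup, let ρ and U_1, …, U_L be d×d complex matrices such that ρ commutes with (A g : Matrix) for every g ∈ G, each U_l is unitary (U_l ∈ Matrix.unitaryGroup) and commutes with (A g : Matrix) for every g ∈ G. Define recursively Õ_L := merge(O) and Õ_{l-1} := merge((U_l)ᴴ * Õ_l * U_l) for l = L, L−1, …, 1. Then Matrix.trace (ρ * Õ_0) = Matrix.trace (ρ * (Uᴴ * O * U)), where U := U_L * U_{L-1} * ⋯ * U_1. -/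
open Matrix

section Expansion

variable {n ι : Type*} [Fintype n] [Fintype ι] [DecidableEq ι] {s : ι → Matrix n n ℂ}

/-- The expansion of a matrix in a trace-orthonormal spanning family. -/
theorem sum_trace_smul_eq_of_trace_orthonormal
    (horth : ∀ i j, trace (s i * s j) = if i = j then 1 else 0)
    (hspan : Submodule.span ℂ (Set.range s) = ⊤) (O : Matrix n n ℂ) :
    ∑ i, trace (s i * O) • s i = O := by
  have hO : O ∈ Submodule.span ℂ (Set.range s) := hspan ▸ Submodule.mem_top
  obtain ⟨c, rfl⟩ := (Submodule.mem_span_range_iff_exists_fun ℂ).1 hO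
  refine Finset.sum_congr rfl fun i _ => ?_
  simp [Finset.mul_sum, trace_sum, horth]

/-- Merging the coefficients of `O` along the blocks of a partition of the index set does not
change its trace pairing with a matrix whose own coefficients are constant on the blocks. -/
theorem trace_mul_sum_block_smul
    (horth : ∀ i j, trace (s i * s j) = if i = j then 1 else 0)
    (hspan : Submodule.span ℂ (Set.range s) = ⊤)
    {R : Finset ι} {block : ι → Finset ι} (hR : ∀ i, ∃! r, r ∈ R ∧ i ∈ block r)
    {σ : Matrix n n ℂ} (hσ : ∀ r, ∀ i ∈ block r, trace (σ * s i) = trace (σ * s r))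
    (O : Matrix n n ℂ) :
    trace (σ * ∑ r ∈ R, (∑ i ∈ block r, trace (s i * O)) • s r) = trace (σ * O) := by
  have hcover : R.biUnion block = Finset.univ := by
    refine Finset.eq_univ_of_forall fun i => ?_
    obtain ⟨r, hr, -⟩ := hR i
    exact Finset.mem_biUnion.2 ⟨r, hr⟩
  have hdisj : (R : Set ι).PairwiseDisjoint block := fun r hr r' hr' hne =>
    Finset.disjoint_left.2 fun i hi hi' => hne ((hR i).unique ⟨hr, hi⟩ ⟨hr', hi'⟩)
  conv_rhs => rw [← sum_trace_smul_eq_of_trace_orthonormal horth hspan O, ← hcover,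
    Finset.sum_biUnion hdisj]
  simp only [Finset.mul_sum, trace_sum, mul_smul_comm, trace_smul, Finset.sum_smul]
  refine Finset.sum_congr rfl fun r _ => Finset.sum_congr rfl fun i hi => ?_
  rw [hσ r i hi]

end Expansion

section Unitary

variable {n : Type*} [Fintype n] [DecidableEq n]

/-- Conjugating the other factor by a unitary commuting with `σ` preserves the trace pairing. -/
theorem trace_mul_conj_of_commute {σ V : Matrix n n ℂ} (hV : V ∈ unitaryGroup n ℂ)
    (h : Commute σ V) (X : Matrix n n ℂ) : trace (σ * (V * X * Vᴴ)) = trace (σ * X) := by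
  have hV' : Vᴴ * V = 1 := mem_unitaryGroup_iff'.1 hV
  calc trace (σ * (V * X * Vᴴ)) = trace (V * (σ * X * Vᴴ)) := by
        rw [Matrix.mul_assoc V, ← Matrix.mul_assoc σ, h.eq, Matrix.mul_assoc, Matrix.mul_assoc σ]
    _ = trace (σ * X) := by rw [trace_mul_comm, Matrix.mul_assoc, hV', Matrix.mul_one]

theorem commute_conjTranspose_of_mem_unitaryGroup {V B : Matrix n n ℂ}
    (hV : V ∈ unitaryGroup n ℂ) (h : Commute V B) : Commute Vᴴ B := by
  have hV₁ : Vᴴ * V = 1 := mem_unitaryGroup_iff'.1 hV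
  have hV₂ : V * Vᴴ = 1 := mem_unitaryGroup_iff.1 hV
  calc Vᴴ * B = Vᴴ * (B * V) * Vᴴ := by
        rw [Matrix.mul_assoc, Matrix.mul_assoc B, hV₂, Matrix.mul_one]
    _ = B * Vᴴ := by rw [← h.eq, ← Matrix.mul_assoc, hV₁, Matrix.one_mul]

/-- If a map `merge` preserves the trace pairing with every matrix commuting with a set `S`, then
interleaving it with Heisenberg evolution by unitaries commuting with `S` preserves the
expectation values of matrices commuting with `S`. -/
theorem trace_mul_interleaved_evolution {S : Set (Matrix n n ℂ)}
    {merge : Matrix n n ℂ → Matrix n n ℂ}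
    (hmerge : ∀ σ, (∀ B ∈ S, Commute σ B) → ∀ X, trace (σ * merge X) = trace (σ * X))
    {L : ℕ} {U : Fin L → Matrix n n ℂ} (hU : ∀ l, U l ∈ unitaryGroup n ℂ)
    (hUS : ∀ l, ∀ B ∈ S, Commute (U l) B) {O : Matrix n n ℂ}
    {Otil : Fin (L + 1) → Matrix n n ℂ} (hlast : Otil (Fin.last L) = merge O)
    (hstep : ∀ l : Fin L, Otil l.castSucc = merge ((U l)ᴴ * Otil l.succ * U l))
    {ρ : Matrix n n ℂ} (hρ : ∀ B ∈ S, Commute ρ B) :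
    trace (ρ * Otil 0) =
      trace (ρ * (((List.ofFn U).reverse.prod)ᴴ * O * (List.ofFn U).reverse.prod)) := by
  induction L generalizing ρ with
  | zero =>
    rw [show (0 : Fin 1) = Fin.last 0 from rfl, hlast, hmerge ρ hρ]
    simp
  | succ L ih =>
    have hσ : ∀ B ∈ S, Commute (U 0 * ρ * (U 0)ᴴ) B := fun B hB =>
      ((hUS 0 B hB).mul_left (hρ B hB)).mul_left
        (commute_conjTranspose_of_mem_unitaryGroup (hU 0) (hUS 0 B hB))
    have hcyc : ∀ X, trace (ρ * ((U 0)ᴴ * X * U 0)) = trace (U 0 * ρ * (U 0)ᴴ * X) := fun X => by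
      rw [← Matrix.mul_assoc, trace_mul_comm]
      simp only [Matrix.mul_assoc]
    have key := ih (U := fun l => U l.succ) (Otil := fun l => Otil l.succ)
      (fun l => hU l.succ) (fun l => hUS l.succ) hlast
      (fun l => hstep l.succ) hσ
    rw [show Otil 0 = merge ((U 0)ᴴ * Otil (Fin.succ 0) * U 0) from hstep 0, hmerge ρ hρ, hcyc,
      key, ← hcyc]
    simp only [List.ofFn_succ, List.reverse_cons, List.prod_append, List.prod_singleton,
      conjTranspose_mul, Matrix.mul_assoc]

end Unitary

/-- Correctness of symmetry-merging Pauli propagation (Theorem 1).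
Setup: `s` is a trace-orthonormal Hermitian basis of `d×d` complex matrices, `G` a finite
group with unitary representation `A` permuting the basis via `π` (i.e.
`A g * s i * (A g)ᴴ = s (π g i)`), `R` a set of orbit representatives (exactly one element
of each orbit of `i ↦ π g i`), and
`merge O = Σ_{r ∈ R} (Σ_{i ∈ orbit of r} Tr (s i * O)) • s r`.
Suppose `ρ` and each unitary layer `U l` commute with every `A g`.  Define recursively
`Õ_L = merge O` and `Õ_{l-1} = merge ((U l)ᴴ * Õ_l * U l)` (here `Otil l.castSucc` plays
the role of `Õ_{l-1}` and `U l` that of the `(l+1)`-st layer in 0-based indexing).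
Then `Tr (ρ * Õ_0) = Tr (ρ * (Uᴴ * O * U))` where `U = U_L * U_{L-1} * ⋯ * U_1`. -/
theorem symmetry_merging_pauli_propagation_correct {d L : ℕ} (hd : 1 ≤ d)
    (s : Fin (d ^ 2) → Matrix (Fin d) (Fin d) ℂ)
    (hherm : ∀ i, (s i)ᴴ = s i)
    (horth : ∀ i j, Matrix.trace (s i * s j) = if i = j then 1 else 0)
    (hspan : Submodule.span ℂ (Set.range s) = ⊤)
    {G : Type*} [Group G] [Fintype G]
    (A : G →* Matrix.unitaryGroup (Fin d) ℂ)
    (π : G →* Equiv.Perm (Fin (d ^ 2)))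
    (hA : ∀ (g : G) (i : Fin (d ^ 2)),
      (A g : Matrix (Fin d) (Fin d) ℂ) * s i * ((A g : Matrix (Fin d) (Fin d) ℂ))ᴴ = s (π g i))
    (R : Finset (Fin (d ^ 2)))
    (hR : ∀ i : Fin (d ^ 2), ∃! r, r ∈ R ∧ i ∈ Finset.univ.image (fun g : G => π g r))
    (merge : Matrix (Fin d) (Fin d) ℂ → Matrix (Fin d) (Fin d) ℂ)
    (hmerge : ∀ O : Matrix (Fin d) (Fin d) ℂ, merge O = ∑ r ∈ R,
      (∑ i ∈ Finset.univ.image (fun g : G => π g r), Matrix.trace (s i * O)) • s r)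
    (ρ : Matrix (Fin d) (Fin d) ℂ)
    (hρ : ∀ g : G, ρ * (A g : Matrix (Fin d) (Fin d) ℂ) = (A g : Matrix (Fin d) (Fin d) ℂ) * ρ)
    (U : Fin L → Matrix (Fin d) (Fin d) ℂ)
    (hU : ∀ l, U l ∈ Matrix.unitaryGroup (Fin d) ℂ)
    (hUsym : ∀ (l : Fin L) (g : G),
      U l * (A g : Matrix (Fin d) (Fin d) ℂ) = (A g : Matrix (Fin d) (Fin d) ℂ) * U l)
    (O : Matrix (Fin d) (Fin d) ℂ)
    (Otil : Fin (L + 1) → Matrix (Fin d) (Fin d) ℂ)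
    (hOtilL : Otil (Fin.last L) = merge O)
    (hOtil : ∀ l : Fin L, Otil l.castSucc = merge ((U l)ᴴ * Otil l.succ * U l)) :
    Matrix.trace (ρ * Otil 0) =
      Matrix.trace (ρ * (((List.ofFn U).reverse.prod)ᴴ * O * (List.ofFn U).reverse.prod)) := by
  refine trace_mul_interleaved_evolution
    (S := Set.range fun g => (A g : Matrix (Fin d) (Fin d) ℂ)) (fun σ hσ X => ?_) hU
    (fun l => Set.forall_mem_range.2 (hUsym l)) hOtilL hOtil (Set.forall_mem_range.2 hρ)
  rw [hmerge]
  refine trace_mul_sum_block_smul horth hspan hR (fun r i hi => ?_) X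
  obtain ⟨g, -, rfl⟩ := Finset.mem_image.1 hi
  rw [← hA]
  exact trace_mul_conj_of_commute (A g).2 (hσ _ ⟨g, rfl⟩) _
end

section
/- Expectation equivalence for orbit representatives (Lemma C.1): under the stated setup, let U be a unitary d×d complex matrix commuting with (A g : Matrix) for every g ∈ G, and let f : Fin (d^2) → ℝ satisfy f (π g i) = f i for all g ∈ G and all i. Then for every g ∈ G and every index j, Σ_{i ∈ Fin (d^2)} Matrix.trace (U * s (π g j) * Uᴴ * s i) * (f i : ℂ) = Σ_{i ∈ Fin (d^2)} Matrix.trace (U * s j * Uᴴ * s i) * (f i : ℂ). -/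
open Matrix

/-- If `U` commutes with an isometry `V`, then conjugating both `X` and `Y` by `V` leaves
`trace (U * X * Uᴴ * Y)` unchanged. -/
theorem Matrix.trace_conj_mul_conj_of_commute {n R : Type*} [Fintype n] [DecidableEq n]
    [CommRing R] [StarRing R] {U V : Matrix n n R} (hV : Vᴴ * V = 1) (hUV : U * V = V * U)
    (X Y : Matrix n n R) :
    trace (U * (V * X * Vᴴ) * Uᴴ * (V * Y * Vᴴ)) = trace (U * X * Uᴴ * Y) := by
  have hVU : Vᴴ * Uᴴ = Uᴴ * Vᴴ := by
    rw [← conjTranspose_mul, ← conjTranspose_mul, hUV]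
  calc trace (U * (V * X * Vᴴ) * Uᴴ * (V * Y * Vᴴ))
      = trace ((U * V) * X * (Vᴴ * Uᴴ) * V * Y * Vᴴ) := by simp only [Matrix.mul_assoc]
    _ = trace (V * (U * X * Uᴴ * (Vᴴ * V) * Y) * Vᴴ) := by
      rw [hUV, hVU]; simp only [Matrix.mul_assoc]
    _ = trace (U * X * Uᴴ * Y) := by
      rw [trace_mul_comm, ← Matrix.mul_assoc, hV, Matrix.one_mul, Matrix.mul_one]

/-- Expectation equivalence for orbit representatives (Lemma C.1).
Setup: `s` is a trace-orthonormal Hermitian basis of `d×d` complex matrices, `G` a finite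
group with unitary representation `A` permuting the basis via `π`
(`A g * s i * (A g)ᴴ = s (π g i)`).  If the unitary `U` commutes with every `A g` and
`f` is invariant under `π`, then propagating `s (π g j)` yields the same expectation
functional as propagating `s j`. -/
theorem expectation_equiv_orbit_representatives {d : ℕ} (hd : 1 ≤ d)
    (s : Fin (d ^ 2) → Matrix (Fin d) (Fin d) ℂ)
    (hherm : ∀ i, (s i)ᴴ = s i)
    (horth : ∀ i j, Matrix.trace (s i * s j) = if i = j then 1 else 0)
    (hspan : Submodule.span ℂ (Set.range s) = ⊤)
    {G : Type*} [Group G] [Fintype G]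
    (A : G →* Matrix.unitaryGroup (Fin d) ℂ)
    (π : G →* Equiv.Perm (Fin (d ^ 2)))
    (hA : ∀ (g : G) (i : Fin (d ^ 2)),
      (A g : Matrix (Fin d) (Fin d) ℂ) * s i * ((A g : Matrix (Fin d) (Fin d) ℂ))ᴴ = s (π g i))
    (U : Matrix (Fin d) (Fin d) ℂ)
    (hU : U ∈ Matrix.unitaryGroup (Fin d) ℂ)
    (hUsym : ∀ g : G,
      U * (A g : Matrix (Fin d) (Fin d) ℂ) = (A g : Matrix (Fin d) (Fin d) ℂ) * U)
    (f : Fin (d ^ 2) → ℝ)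
    (hf : ∀ (g : G) (i : Fin (d ^ 2)), f (π g i) = f i) :
    ∀ (g : G) (j : Fin (d ^ 2)),
      ∑ i : Fin (d ^ 2), Matrix.trace (U * s (π g j) * Uᴴ * s i) * (f i : ℂ) =
        ∑ i : Fin (d ^ 2), Matrix.trace (U * s j * Uᴴ * s i) * (f i : ℂ) := by
  intro g j
  rw [← Equiv.sum_comp (π g)]
  refine Finset.sum_congr rfl fun i _ => ?_
  rw [hf, ← hA g j, ← hA g i,
    trace_conj_mul_conj_of_commute (mem_unitaryGroup_iff'.mp (A g).2) (hUsym g)]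
end

section
/- Pauli path integral expansion: let d ≥ 1, let s : Fin (d^2) → Matrix (Fin d) (Fin d) ℂ be a trace-orthonormal Hermitian basis, and let U_1, …, U_L and O be d×d complex matrices. With U := U_L * U_{L-1} * ⋯ * U_1, one has Uᴴ * O * U = Σ over all path tuples p : Fin (L+1) → Fin (d^2) of (Matrix.trace (s (p L) * O) * ∏_{l=1}^{L} Matrix.trace (s (p (l-1)) * (U_l)ᴴ * s (p l) * U_l)) • s (p 0). -/
open Matrix

/-- A trace-orthonormal spanning family reproduces every matrix from its trace coefficients. -/
theorem sum_trace_mul_smul_eq {ι n : Type*} [Fintype ι] [DecidableEq ι] [Fintype n]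
    {s : ι → Matrix n n ℂ}
    (horth : ∀ i j, Matrix.trace (s i * s j) = if i = j then 1 else 0)
    (hspan : Submodule.span ℂ (Set.range s) = ⊤) (X : Matrix n n ℂ) :
    ∑ i, Matrix.trace (s i * X) • s i = X := by
  have hX : X ∈ Submodule.span ℂ (Set.range s) := hspan ▸ Submodule.mem_top
  obtain ⟨c, rfl⟩ := (Submodule.mem_span_range_iff_exists_fun ℂ).mp hX
  simp [Finset.mul_sum, Matrix.trace_sum, horth]

/-- Pauli path integral expansion: for a trace-orthonormal Hermitian basis `s` of the `d×d`
complex matrices and layers `U 0, …, U (L-1)` (0-based; `U l` is the `(l+1)`-st layer),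
with `Uprod = U_L * U_{L-1} * ⋯ * U_1 = (List.ofFn U).reverse.prod`, the Heisenberg-evolved
observable expands as a sum over all Pauli paths `p : Fin (L+1) → Fin (d^2)`. -/
theorem pauli_path_integral {d L : ℕ} (hd : 1 ≤ d)
    (s : Fin (d ^ 2) → Matrix (Fin d) (Fin d) ℂ)
    (hherm : ∀ i, (s i)ᴴ = s i)
    (horth : ∀ i j, Matrix.trace (s i * s j) = if i = j then 1 else 0)
    (hspan : Submodule.span ℂ (Set.range s) = ⊤)
    (U : Fin L → Matrix (Fin d) (Fin d) ℂ)
    (O : Matrix (Fin d) (Fin d) ℂ) :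
    ((List.ofFn U).reverse.prod)ᴴ * O * (List.ofFn U).reverse.prod =
      ∑ p : Fin (L + 1) → Fin (d ^ 2),
        (Matrix.trace (s (p (Fin.last L)) * O) *
            ∏ l : Fin L,
              Matrix.trace (s (p l.castSucc) * ((U l)ᴴ * s (p l.succ) * U l))) •
          s (p 0) := by
  induction L with
  | zero =>
    rw [← (Equiv.funUnique (Fin 1) (Fin (d ^ 2))).symm.sum_comp]
    simpa using (sum_trace_mul_smul_eq horth hspan O).symm
  | succ L ih =>
    have hstep : ((List.ofFn U).reverse.prod)ᴴ * O * (List.ofFn U).reverse.prod =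
        (U 0)ᴴ * (((List.ofFn fun l => U l.succ).reverse.prod)ᴴ * O *
          (List.ofFn fun l => U l.succ).reverse.prod) * U 0 := by
      simp [List.ofFn_succ, Matrix.conjTranspose_mul, Matrix.mul_assoc]
    rw [hstep, ih fun l => U l.succ, ← (Fin.consEquiv fun _ : Fin (L + 2) => Fin (d ^ 2)).sum_comp,
      Fintype.sum_prod_type_right, Matrix.mul_sum, Matrix.sum_mul]
    refine Fintype.sum_congr _ _ fun q => ?_
    rw [Matrix.mul_smul, Matrix.smul_mul,
      ← sum_trace_mul_smul_eq horth hspan ((U 0)ᴴ * s (q 0) * U 0), Finset.smul_sum]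
    refine Fintype.sum_congr _ _ fun i => ?_
    simp only [Fin.consEquiv_apply, Fin.prod_univ_succ, ← Fin.succ_last, Fin.cons_succ,
      Fin.castSucc_zero, Fin.cons_zero, ← Fin.succ_castSucc, smul_smul]
    congr 1
    ring
end

section
/- Necklace sum identity for powers of two: let m ≥ 1 and n := 2^m. Then Σ_{j=1}^{n} 4^(Nat.gcd j n) = (Σ_{k=1}^{m} 4^(2^(k-1)) * 2^(m-k)) + 4^n. -/
/-- A sum of a function of `gcd j n` over `1 ≤ j ≤ n`, grouped by the value of the gcd. -/
theorem sum_Icc_gcd_eq_sum_divisors {n : ℕ} (hn : n ≠ 0) (f : ℕ → ℕ) :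
    ∑ j ∈ Finset.Icc 1 n, f (Nat.gcd j n) =
      ∑ d ∈ n.divisors, f d * Nat.totient (n / d) := by
  have hrange : ∑ j ∈ Finset.Icc 1 n, f (Nat.gcd j n) =
      ∑ j ∈ Finset.range n, f (Nat.gcd n j) := by
    rw [Finset.range_eq_Ico, ← Finset.Ico_add_one_right_eq_Icc,
      Finset.sum_Ico_succ_top (Nat.one_le_iff_ne_zero.mpr hn),
      Finset.sum_eq_sum_Ico_succ_bot (Nat.pos_of_ne_zero hn), add_comm]
    simp [Nat.gcd_comm]
  rw [hrange, ← Finset.sum_fiberwise_of_maps_to (t := n.divisors) (g := fun j => Nat.gcd n j)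
    (fun j _ => Nat.mem_divisors.mpr ⟨Nat.gcd_dvd_left n j, hn⟩)]
  refine Finset.sum_congr rfl fun d hd => ?_
  rw [Nat.totient_div_of_dvd (Nat.dvd_of_mem_divisors hd),
    Finset.sum_congr rfl fun j hj => congrArg f (Finset.mem_filter.mp hj).2,
    Finset.sum_const, smul_eq_mul, mul_comm]

/-- Necklace sum identity for powers of two: with `n = 2^m`,
`Σ_{j=1}^{n} 4^(gcd j n) = (Σ_{k=1}^{m} 4^(2^(k-1)) * 2^(m-k)) + 4^n`. -/
theorem necklace_sum_pow_two {m : ℕ} (hm : 1 ≤ m) :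
    ∑ j ∈ Finset.Icc 1 (2 ^ m), 4 ^ Nat.gcd j (2 ^ m) =
      (∑ k ∈ Finset.Icc 1 m, 4 ^ (2 ^ (k - 1)) * 2 ^ (m - k)) + 4 ^ (2 ^ m) := by
  rw [sum_Icc_gcd_eq_sum_divisors (pow_ne_zero m two_ne_zero) (4 ^ ·),
    Nat.sum_divisors_prime_pow Nat.prime_two, Finset.sum_range_succ,
    Nat.div_self (by positivity), Nat.totient_one, mul_one,
    ← Finset.Ico_add_one_right_eq_Icc, Finset.sum_Ico_eq_sum_range, Nat.add_sub_cancel]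
  congr 1
  refine Finset.sum_congr rfl fun i hi => ?_
  have hi : i < m := Finset.mem_range.mp hi
  rw [Nat.pow_div hi.le two_pos, Nat.totient_prime_pow Nat.prime_two (Nat.sub_pos_of_lt hi),
    Nat.add_sub_cancel_left, Nat.sub_sub, add_comm 1 i]
  simp
end

section
/- Orbit-count upper bound for power-of-two length: let m ≥ 1, n := 2^m, and consider the rotation action of ZMod n on X_n := (ZMod n → Fin 4) given by (j • f)(i) = f(i + j). Then n * Nat.card (orbit-relation quotient of this action) ≤ 2 * 4^n, i.e. the number of orbit representatives is at most 2 * 4^n / n. -/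
/-- The cyclic rotation action of `ZMod n` on `n`-qubit Pauli strings
`X_n = (ZMod n → Fin 4)`, given by `(j +ᵥ f) i = f (i + j)`. -/
instance rotVAdd (n : ℕ) : VAdd (ZMod n) (ZMod n → Fin 4) :=
  ⟨fun j f => fun i => f (i + j)⟩

instance rotAddAction (n : ℕ) : AddAction (ZMod n) (ZMod n → Fin 4) where
  zero_vadd f := by funext i; show f (i + 0) = f i; rw [add_zero]
  add_vadd j k f := by
    funext i
    show f (i + (j + k)) = f ((i + j) + k)
    rw [add_assoc]

/-- A string fixed by a nonzero rotation is determined by its values on representatives of the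
cosets of the subgroup generated by that rotation, of which there are at most `n / 2`. -/
lemma card_fixedBy_rot_le {n : ℕ} [NeZero n] {j : ZMod n} (hj : j ≠ 0) :
    Nat.card (AddAction.fixedBy (ZMod n → Fin 4) j) ≤ 2 ^ n := by
  let H := AddSubgroup.zmultiples j
  have hinj : Function.Injective
      (fun (f : AddAction.fixedBy (ZMod n → Fin 4) j) (q : ZMod n ⧸ H) => f.1 q.out) := by
    have hper (f : AddAction.fixedBy (ZMod n → Fin 4) j) (i : ZMod n) :
        f.1 (i : ZMod n ⧸ H).out = f.1 i := by
      obtain ⟨h, hh⟩ := QuotientAddGroup.mk_out_eq_add H i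
      have hstab : H ≤ AddAction.stabilizer (ZMod n) f.1 := by
        rw [AddSubgroup.zmultiples_le]
        exact f.2
      rw [hh]
      exact congrFun (hstab h.2) i
    intro f g hfg
    ext1
    funext i
    rw [← hper f i, ← hper g i]
    exact congrFun hfg i
  have hcard : Nat.card (ZMod n ⧸ H) * 2 ≤ n := by
    have hH : 2 ≤ Nat.card H := by
      have : Nontrivial H :=
        (AddSubgroup.nontrivial_iff_ne_bot H).2 (AddSubgroup.zmultiples_ne_bot.2 hj)
      exact Finite.one_lt_card
    calc Nat.card (ZMod n ⧸ H) * 2 ≤ Nat.card (ZMod n ⧸ H) * Nat.card H :=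
          Nat.mul_le_mul_left _ hH
      _ = n := by rw [← AddSubgroup.card_eq_card_quotient_mul_card_addSubgroup, Nat.card_zmod]
  calc Nat.card (AddAction.fixedBy (ZMod n → Fin 4) j)
      ≤ Nat.card (ZMod n ⧸ H → Fin 4) := Nat.card_le_card_of_injective _ hinj
    _ = 2 ^ (2 * Nat.card (ZMod n ⧸ H)) := by
        norm_num [Nat.card_fun, pow_mul]
    _ ≤ 2 ^ n := Nat.pow_le_pow_right two_pos (by omega)

/-- The orbit-count bound holds for every positive length. -/
lemma mul_card_rot_orbits_le (n : ℕ) [NeZero n] :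
    n * Nat.card (AddAction.orbitRel.Quotient (ZMod n) (ZMod n → Fin 4)) ≤ 2 * 4 ^ n := by
  classical
  have : Fintype (AddAction.orbitRel.Quotient (ZMod n) (ZMod n → Fin 4)) := Fintype.ofFinite _
  have hburnside :=
    AddAction.sum_card_fixedBy_eq_card_orbits_mul_card_addGroup (ZMod n) (ZMod n → Fin 4)
  rw [ZMod.card, mul_comm] at hburnside
  rw [Nat.card_eq_fintype_card]
  refine hburnside.symm.le.trans ?_
  rw [← Finset.add_sum_erase _ _ (Finset.mem_univ (0 : ZMod n)), two_mul]
  refine Nat.add_le_add ?_ ?_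
  · refine (Fintype.card_subtype_le _).trans_eq ?_
    simp [ZMod.card]
  · calc ∑ j ∈ Finset.univ.erase (0 : ZMod n),
          Fintype.card (AddAction.fixedBy (ZMod n → Fin 4) j)
        ≤ (Finset.univ.erase (0 : ZMod n)).card * 2 ^ n := by
          refine Finset.sum_le_card_nsmul _ _ _ fun j hj => ?_
          rw [← Nat.card_eq_fintype_card]
          exact card_fixedBy_rot_le (Finset.ne_of_mem_erase hj)
      _ ≤ 2 ^ n * 2 ^ n := by
          refine Nat.mul_le_mul_right _ ((Finset.card_le_univ _).trans ?_)
          rw [ZMod.card]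
          exact Nat.lt_two_pow_self.le
      _ = 4 ^ n := by norm_num [← mul_pow]

/-- Orbit-count upper bound for power-of-two length: with `n = 2^m`, the number of orbits
of the rotation action of `ZMod n` on `(ZMod n → Fin 4)` satisfies
`n * (number of orbits) ≤ 2 * 4^n`. -/
theorem necklace_count_pow_two_upper_bound {m : ℕ} (hm : 1 ≤ m) :
    2 ^ m * Nat.card (AddAction.orbitRel.Quotient (ZMod (2 ^ m)) (ZMod (2 ^ m) → Fin 4)) ≤
      2 * 4 ^ (2 ^ m) := by
  exact mod_cast mul_card_rot_orbits_le (2 ^ m)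
end
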